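/- (q-gram spectrum kernel on SLPs) Let an SLP X_1,…,X_{n_1} represent T_1 and an SLP Y_1,…,Y_{n_2} represent T_2, both over the same finite alphabet Σ, and let q ≥ 2. Then the q-gram spectrum kernel K_q(T_1, T_2) = Σ_{P ∈ Σ^q} |Occ(T_1, P)|·|Occ(T_2, P)| satisfies K_q(T_1, T_2) = Σ_{i : X_i = X_ℓ X_r} Σ_{j : Y_j = Y_{ℓ'} Y_{r'}} vOcc(X_i)·vOcc(Y_j)·Σ_{P ∈ Σ^q} |Occ(t_i, P)|·|Occ(t'_j, P)|, where t_i = suf(val(X_ℓ), q−1)·pre(val(X_r), q−1) for X_i = X_ℓ X_r in the first SLP and t'_j = suf(val(Y_{ℓ'}), q−1)·pre(val(Y_{r'}), q−1) for Y_j = Y_{ℓ'} Y_{r'} in the second SLP (all sums over P have finite support since only q-grams occurring in the respective strings contribute). -/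

import Mathlib

/-- The substring `S[u:v]` (1-indexed, inclusive; empty if `v < u`). -/
def substr {α : Type*} (S : List α) (u v : ℕ) : List α := (S.drop (u - 1)).take (v + 1 - u)

/-- `pre(S,q) = S[1:min(q,|S|)]`, the length-`q` prefix of `S`. -/
def pre {α : Type*} (S : List α) (q : ℕ) : List α := S.take q

/-- `suf(S,q) = S[max(1,|S|-q+1):|S|]`, the length-`q` suffix of `S`. -/
def suf {α : Type*} (S : List α) (q : ℕ) : List α := S.drop (S.length - q)

/-- `Occ(T,P) = {k ≥ 1 : T[k:k+|P|-1] = P}`. -/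
def Occ {α : Type*} (T P : List α) : Set ℕ := {k | 1 ≤ k ∧ substr T k (k + P.length - 1) = P}

/-- A straight-line program of size `n`: each variable `X_i` (0-indexed here) is either a
terminal `a ∈ Σ` or a concatenation `X_ℓ X_r` with `ℓ, r < i`. -/
structure SLP (α : Type*) (n : ℕ) where
  rule : Fin n → α ⊕ (Fin n × Fin n)
  wf : ∀ i l r, rule i = Sum.inr (l, r) → l < i ∧ r < i

namespace SLP

variable {α : Type*} {n : ℕ}

/-- The string `val(X_i)` derived by variable `X_i`. -/
def val (S : SLP α n) : Fin n → List α
  | i =>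
    match h : S.rule i with
    | Sum.inl a => [a]
    | Sum.inr (l, r) => S.val l ++ S.val r
termination_by i => i.val
decreasing_by
  · exact (S.wf i l r h).1
  · exact (S.wf i l r h).2

/-- The set `itv(X_i)` of occurrence intervals of `X_i` in the derivation of `T = val(X_n)`. -/
def itv (S : SLP α n) : Fin n → Set (ℕ × ℕ)
  | i =>
    if i.val = n - 1 then {(1, (S.val i).length)}
    else
      {p | ∃ k l, ∃ h : S.rule k = Sum.inr (l, i),
          ∃ uv ∈ S.itv k, p = (uv.1 + (S.val l).length, uv.2)} ∪
      {p | ∃ k r, ∃ h : S.rule k = Sum.inr (i, r),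
          ∃ uv ∈ S.itv k, p = (uv.1, uv.1 + (S.val i).length - 1)}
termination_by i => n - i.val
decreasing_by
  · have h1 : (i : ℕ) < (k : ℕ) := (S.wf k l i h).2
    have h2 : (k : ℕ) < n := k.isLt
    omega
  · have h1 : (i : ℕ) < (k : ℕ) := (S.wf k i r h).1
    have h2 : (k : ℕ) < n := k.isLt
    omega

/-- `vOcc(X_i) = |itv(X_i)|`. -/
noncomputable def vOcc (S : SLP α n) (i : Fin n) : ℕ := (S.itv i).ncard

end SLP

namespace SLP

/-- For a concatenation variable `X_i = X_ℓ X_r`, the string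
`t_i = suf(val(X_ℓ), q-1) · pre(val(X_r), q-1)` (and `[]` for terminal variables). -/
def tstr {α : Type*} {n : ℕ} (S : SLP α n) (q : ℕ) (i : Fin n) : List α :=
  match S.rule i with
  | Sum.inl _ => []
  | Sum.inr (l, r) => suf (S.val l) (q - 1) ++ pre (S.val r) (q - 1)

end SLP

theorem mem_Occ_iff {α : Type*} (T P : List α) (k : ℕ) (hP : 1 ≤ P.length) :
    k ∈ Occ T P ↔ 1 ≤ k ∧ ∀ m < P.length, T[k - 1 + m]? = P[m]? := by
  unfold Occ substr
  simp only [Set.mem_setOf_eq]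
  refine and_congr_right fun hk => ?_
  have h1 : k + P.length - 1 + 1 - k = P.length := by omega
  rw [h1]
  constructor
  · intro h m hm
    conv_rhs => rw [← h]
    rw [List.getElem?_take, if_pos hm, List.getElem?_drop]
  · intro h
    apply List.ext_getElem?
    intro m
    rw [List.getElem?_take, List.getElem?_drop]
    split_ifs with hm
    · exact h m hm
    · rw [List.getElem?_eq_none (by omega)]

theorem Occ_bound {α : Type*} {T P : List α} {k : ℕ} (hP : 1 ≤ P.length) (h : k ∈ Occ T P) :
    1 ≤ k ∧ k - 1 + P.length ≤ T.length := by
  rw [mem_Occ_iff _ _ _ hP] at h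
  refine ⟨h.1, ?_⟩
  have h2 := h.2 (P.length - 1) (by omega)
  by_contra hc
  rw [List.getElem?_eq_none (by omega), List.getElem?_eq_getElem (by omega)] at h2
  simp at h2

theorem Occ_finite {α : Type*} (T P : List α) (hP : 1 ≤ P.length) : (Occ T P).Finite :=
  (Set.finite_Iic (T.length + 1)).subset fun k hk => by
    have := Occ_bound hP hk
    simp only [Set.mem_Iic]; omega

theorem t_length {α : Type*} (A B : List α) (q : ℕ) :
    (suf A (q - 1) ++ pre B (q - 1)).length
      = (A.length - (A.length - (q - 1))) + min (q - 1) B.length := by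
  simp [suf, pre]

theorem t_get {α : Type*} (A B : List α) (q m : ℕ)
    (hm : m < (A.length - (A.length - (q - 1))) + min (q - 1) B.length) :
    (suf A (q - 1) ++ pre B (q - 1))[m]? = (A ++ B)[A.length - (q - 1) + m]? := by
  unfold suf pre
  rw [List.getElem?_append, List.getElem?_append, List.getElem?_drop, List.getElem?_take,
    List.length_drop]
  split_ifs with h1 h2 h3 h4
  · rfl
  · omega
  · omega
  · congr 1; omega
  · omega
  · omega

theorem Occ_append {α : Type*} (A B P : List α) (q : ℕ) (hq : 2 ≤ q) (hP : P.length = q) :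
    (Occ (A ++ B) P).ncard = (Occ A P).ncard + (Occ B P).ncard
      + (Occ (suf A (q - 1) ++ pre B (q - 1)) P).ncard := by
  have hP1 : 1 ≤ P.length := by omega
  set t := suf A (q - 1) ++ pre B (q - 1) with ht
  have hlen := t_length A B q
  rw [← ht] at hlen
  have hget := t_get A B q
  rw [← ht] at hget
  have e : Occ (A ++ B) P = (Occ A P ∪ (fun k => A.length + k) '' Occ B P)
      ∪ (fun k => (A.length - (q - 1)) + k) '' Occ t P := by
    ext k
    constructor
    · intro h
      have hb := Occ_bound hP1 h
      rw [List.length_append] at hb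
      rw [mem_Occ_iff _ _ _ hP1] at h
      by_cases c1 : k - 1 + q ≤ A.length
      · left; left
        rw [mem_Occ_iff _ _ _ hP1]
        refine ⟨h.1, fun m hm => ?_⟩
        rw [← h.2 m hm, List.getElem?_append_left (by omega)]
      · by_cases c2 : A.length < k
        · left; right
          refine ⟨k - A.length, ?_, by simp; omega⟩
          rw [mem_Occ_iff _ _ _ hP1]
          refine ⟨by omega, fun m hm => ?_⟩
          rw [← h.2 m hm, List.getElem?_append_right (by omega)]
          congr 1; omega
        · right
          refine ⟨k - (A.length - (q - 1)), ?_, by simp; omega⟩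
          rw [mem_Occ_iff _ _ _ hP1]
          refine ⟨by omega, fun m hm => ?_⟩
          rw [← h.2 m hm, hget _ (by omega)]
          congr 1; omega
    · rintro ((h | ⟨j, h, rfl⟩) | ⟨j, h, rfl⟩)
      · have hb := Occ_bound hP1 h
        rw [mem_Occ_iff _ _ _ hP1] at h ⊢
        refine ⟨h.1, fun m hm => ?_⟩
        rw [← h.2 m hm, List.getElem?_append_left (by omega)]
      · have hb := Occ_bound hP1 h
        rw [mem_Occ_iff _ _ _ hP1] at h ⊢
        beta_reduce
        refine ⟨by omega, fun m hm => ?_⟩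
        rw [← h.2 m hm, List.getElem?_append_right (by omega)]
        congr 1; omega
      · have hb := Occ_bound hP1 h
        rw [mem_Occ_iff _ _ _ hP1] at h ⊢
        beta_reduce
        refine ⟨by omega, fun m hm => ?_⟩
        rw [← h.2 m hm, hget _ (by omega)]
        congr 1; omega
  have fA := Occ_finite A P hP1
  have fB := (Occ_finite B P hP1).image (fun k => A.length + k)
  have ft := (Occ_finite t P hP1).image (fun k => (A.length - (q - 1)) + k)
  rw [e, Set.ncard_union_eq ?_ (fA.union fB) ft, Set.ncard_union_eq ?_ fA fB,
    Set.ncard_image_of_injective _ (fun a b h => by simpa using h),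
    Set.ncard_image_of_injective _ (fun a b h => by simpa using h)]
  · rw [Set.disjoint_left]
    rintro k h ⟨j, h', rfl⟩
    beta_reduce at h
    have hb := Occ_bound hP1 h
    have hb' := Occ_bound hP1 h'
    omega
  · rw [Set.disjoint_left]
    rintro k (h | ⟨i, h, rfl⟩) ⟨j, h', he⟩
    · have hb := Occ_bound hP1 h
      have hb' := Occ_bound hP1 h'
      simp only at he
      omega
    · have hb := Occ_bound hP1 h
      have hb' := Occ_bound hP1 h'
      simp only at he
      omega

theorem Occ_singleton {α : Type*} (a : α) (P : List α) (hP : 2 ≤ P.length) :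
    (Occ [a] P).ncard = 0 := by
  have : Occ [a] P = ∅ := by
    ext k
    simp only [Set.mem_empty_iff_false, iff_false]
    intro h
    have := Occ_bound (by omega) h
    simp only [List.length_cons, List.length_nil] at this; omega
  rw [this, Set.ncard_empty]

theorem Occ_nil {α : Type*} (P : List α) (hP : 2 ≤ P.length) :
    (Occ ([] : List α) P).ncard = 0 := by
  have : Occ ([] : List α) P = ∅ := by
    ext k
    simp only [Set.mem_empty_iff_false, iff_false]
    intro h
    have := Occ_bound (by omega) h
    simp only [List.length_cons, List.length_nil] at this; omega
  rw [this, Set.ncard_empty]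

namespace SLP

theorem val_inl {α : Type*} {n : ℕ} (S : SLP α n) {i : Fin n} {a : α}
    (h : S.rule i = Sum.inl a) : S.val i = [a] := by
  rw [val]
  split
  · rename_i b hb
    rw [h] at hb; cases hb; rfl
  · rename_i l r hb
    rw [h] at hb; cases hb

theorem val_inr {α : Type*} {n : ℕ} (S : SLP α n) {i l r : Fin n}
    (h : S.rule i = Sum.inr (l, r)) : S.val i = S.val l ++ S.val r := by
  rw [val]
  split
  · rename_i b hb
    rw [h] at hb; cases hb
  · rename_i l' r' hb
    rw [h] at hb; cases hb; rfl

theorem val_pos {α : Type*} {n : ℕ} (S : SLP α n) (i : Fin n) : 1 ≤ (S.val i).length := by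
  induction i using WellFoundedLT.induction with
  | ind i ih =>
    rcases h : S.rule i with a | ⟨l, r⟩
    · rw [S.val_inl h]; simp
    · rw [S.val_inr h, List.length_append]
      have := ih l (S.wf i l r h).1
      omega

theorem itv_last {α : Type*} {n : ℕ} (S : SLP α n) {i : Fin n} (h : i.val = n - 1) :
    S.itv i = {(1, (S.val i).length)} := by
  rw [itv, if_pos h]

theorem itv_not_last {α : Type*} {n : ℕ} (S : SLP α n) {i : Fin n} (h : i.val ≠ n - 1) :
    S.itv i = {p | ∃ k l, ∃ _ : S.rule k = Sum.inr (l, i),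
          ∃ uv ∈ S.itv k, p = (uv.1 + (S.val l).length, uv.2)} ∪
      {p | ∃ k r, ∃ _ : S.rule k = Sum.inr (i, r),
          ∃ uv ∈ S.itv k, p = (uv.1, uv.1 + (S.val i).length - 1)} := by
  rw [itv, if_neg h]

/-- induction from the last variable downwards -/
theorem down_induction {n : ℕ} {C : Fin n → Prop}
    (h : ∀ i, (∀ k, i < k → C k) → C i) (i : Fin n) : C i := by
  induction i using WellFoundedGT.induction with
  | ind i ih => exact h i ih

theorem itv_snd {α : Type*} {n : ℕ} (S : SLP α n) (i : Fin n) :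
    ∀ p ∈ S.itv i, p.2 + 1 = p.1 + (S.val i).length := by
  induction i using down_induction with
  | h i ih =>
    intro p hp
    by_cases hi : i.val = n - 1
    · rw [S.itv_last hi] at hp
      rw [Set.mem_singleton_iff] at hp
      subst hp
      simp only; omega
    · rw [S.itv_not_last hi] at hp
      rcases hp with ⟨k, l, h, uv, huv, rfl⟩ | ⟨k, r, h, uv, huv, rfl⟩
      · have := ih k (S.wf _ _ _ h).2 uv huv
        rw [S.val_inr h, List.length_append] at this
        simp only; omega
      · have := S.val_pos i
        simp only; omega

/-- start positions of occurrences -/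
def st {α : Type*} {n : ℕ} (S : SLP α n) (i : Fin n) : Set ℕ := Prod.fst '' S.itv i

theorem ncard_st {α : Type*} {n : ℕ} (S : SLP α n) (i : Fin n) :
    (S.st i).ncard = S.vOcc i := by
  unfold st vOcc
  apply Set.InjOn.ncard_image
  intro p hp p' hp' h
  have h1 := S.itv_snd i p hp
  have h2 := S.itv_snd i p' hp'
  ext
  · exact h
  · omega

theorem st_last {α : Type*} {n : ℕ} (S : SLP α n) {i : Fin n} (h : i.val = n - 1) :
    S.st i = {1} := by
  rw [st, S.itv_last h]; simp

/-- contribution of the child `b` of variable `k` to the start positions of `i` -/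
def contr {α : Type*} {n : ℕ} (S : SLP α n) (i : Fin n) (c : Fin n × Bool) : Set ℕ :=
  match S.rule c.1 with
  | Sum.inl _ => ∅
  | Sum.inr (l, r) =>
    match c.2 with
    | true => if l = i then S.st c.1 else ∅
    | false => if r = i then (fun u => u + (S.val l).length) '' S.st c.1 else ∅

theorem mem_contr_true {α : Type*} {n : ℕ} (S : SLP α n) (i k : Fin n) (x : ℕ) :
    x ∈ S.contr i (k, true) ↔ ∃ r, S.rule k = Sum.inr (i, r) ∧ x ∈ S.st k := by
  unfold contr
  rcases h : S.rule k with a | ⟨l, r⟩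
  · simp [h]
  · by_cases hl : l = i <;> simp [h, hl]

theorem mem_contr_false {α : Type*} {n : ℕ} (S : SLP α n) (i k : Fin n) (x : ℕ) :
    x ∈ S.contr i (k, false) ↔
      ∃ l, S.rule k = Sum.inr (l, i) ∧ ∃ u ∈ S.st k, x = u + (S.val l).length := by
  unfold contr
  rcases h : S.rule k with a | ⟨l, r⟩
  · simp [h]
  · by_cases hl : r = i
    · simp [h, hl, eq_comm]
    · simp [h, hl]

theorem st_not_last {α : Type*} {n : ℕ} (S : SLP α n) {i : Fin n} (h : i.val ≠ n - 1) :
    S.st i = ⋃ c, S.contr i c := by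
  ext x
  simp only [Set.mem_iUnion, Prod.exists, Bool.exists_bool, mem_contr_true, mem_contr_false]
  rw [st, S.itv_not_last h]
  constructor
  · rintro ⟨p, hp, rfl⟩
    rcases hp with ⟨k, l, h, uv, huv, rfl⟩ | ⟨k, r, h, uv, huv, rfl⟩
    · exact ⟨k, Or.inl ⟨l, h, uv.1, ⟨uv, huv, rfl⟩, rfl⟩⟩
    · exact ⟨k, Or.inr ⟨r, h, ⟨uv, huv, rfl⟩⟩⟩
  · rintro ⟨k, ⟨l, h, u, ⟨uv, huv, rfl⟩, rfl⟩ | ⟨r, h, ⟨uv, huv, rfl⟩⟩⟩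
    · exact ⟨_, Or.inl ⟨k, l, h, uv, huv, rfl⟩, rfl⟩
    · exact ⟨_, Or.inr ⟨k, r, h, uv, huv, rfl⟩, rfl⟩

/-- one step down the derivation tree towards position `x` -/
def stp {α : Type*} {n : ℕ} (S : SLP α n) (x : ℕ) (s : Fin n × ℕ) : Fin n × ℕ :=
  match S.rule s.1 with
  | Sum.inl _ => s
  | Sum.inr (l, r) =>
    if x < s.2 + (S.val l).length then (l, s.2) else (r, s.2 + (S.val l).length)

theorem stp_inr {α : Type*} {n : ℕ} (S : SLP α n) (x : ℕ) {k l r : Fin n} (u : ℕ)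
    (h : S.rule k = Sum.inr (l, r)) : S.stp x (k, u) =
    if x < u + (S.val l).length then (l, u) else (r, u + (S.val l).length) := by
  simp [stp, h]

theorem stp_le {α : Type*} {n : ℕ} (S : SLP α n) (x : ℕ) (s : Fin n × ℕ) :
    (S.stp x s).1 ≤ s.1 := by
  obtain ⟨k, u⟩ := s
  rcases h : S.rule k with a | ⟨l, r⟩
  · simp [stp, h]
  · rw [S.stp_inr x u h]
    have := S.wf _ _ _ h
    split_ifs
    · exact this.1.le
    · exact this.2.le

theorem stp_iter_le {α : Type*} {n : ℕ} (S : SLP α n) (x : ℕ) (s : Fin n × ℕ) (m d : ℕ) :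
    ((S.stp x)^[m + d] s).1 ≤ ((S.stp x)^[m] s).1 := by
  induction d with
  | zero => simp
  | succ d ih =>
    rw [← Nat.add_assoc, Function.iterate_succ_apply']
    exact (S.stp_le x _).trans ih

theorem exists_iter {α : Type*} {n : ℕ} (S : SLP α n) (x : ℕ) (top : Fin n)
    (htop : top.val = n - 1) (i : Fin n) :
    ∀ u ∈ S.st i, u ≤ x → x < u + (S.val i).length → ∃ m, (S.stp x)^[m] (top, 1) = (i, u) := by
  induction i using down_induction with
  | h i ih =>
    intro u hu h1 h2
    by_cases hi : i.val = n - 1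
    · rw [S.st_last hi, Set.mem_singleton_iff] at hu
      subst hu
      have : i = top := Fin.ext (by omega)
      exact ⟨0, by simp [this]⟩
    · rw [S.st_not_last hi] at hu
      simp only [Set.mem_iUnion, Prod.exists, Bool.exists_bool, mem_contr_true,
        mem_contr_false] at hu
      rcases hu with ⟨k, ⟨l, h, u, hu, rfl⟩ | ⟨r, h, hu⟩⟩
      · have hv := congrArg List.length (S.val_inr h)
        rw [List.length_append] at hv
        obtain ⟨m, hm⟩ := ih k (S.wf _ _ _ h).2 u hu (by omega) (by omega)
        refine ⟨m + 1, ?_⟩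
        rw [Function.iterate_succ_apply', hm, S.stp_inr x u h, if_neg (by omega)]
      · have hv := congrArg List.length (S.val_inr h)
        rw [List.length_append] at hv
        obtain ⟨m, hm⟩ := ih k (S.wf _ _ _ h).1 u hu (by omega) (by omega)
        refine ⟨m + 1, ?_⟩
        rw [Function.iterate_succ_apply', hm, S.stp_inr x u h, if_pos (by omega)]

/-- a contribution at position `x` comes from a node on the path to `x` -/
theorem contr_parent {α : Type*} {n : ℕ} (S : SLP α n) (x : ℕ) (top : Fin n)
    (htop : top.val = n - 1) (i k : Fin n) (b : Bool) (hx : x ∈ S.contr i (k, b)) :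
    i < k ∧ ∃ u m, (S.stp x)^[m] (top, 1) = (k, u) ∧ (S.stp x)^[m + 1] (top, 1) = (i, x) ∧
      (b = true ↔ u = x) := by
  have hp := S.val_pos i
  cases b
  · rw [mem_contr_false] at hx
    obtain ⟨l, h, u, hu, rfl⟩ := hx
    have hv := congrArg List.length (S.val_inr h)
    rw [List.length_append] at hv
    obtain ⟨m, hm⟩ := S.exists_iter (u + (S.val l).length) top htop k u hu (by omega) (by omega)
    have := S.val_pos l
    refine ⟨(S.wf _ _ _ h).2, u, m, hm, ?_, ?_⟩
    · rw [Function.iterate_succ_apply', hm, S.stp_inr _ u h, if_neg (by omega)]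
    · simp; intro h; simp [h] at this
  · rw [mem_contr_true] at hx
    obtain ⟨r, h, hu⟩ := hx
    have hv := congrArg List.length (S.val_inr h)
    rw [List.length_append] at hv
    obtain ⟨m, hm⟩ := S.exists_iter x top htop k x hu (by omega) (by omega)
    refine ⟨(S.wf _ _ _ h).1, x, m, hm, ?_, by simp⟩
    rw [Function.iterate_succ_apply', hm, S.stp_inr _ x h, if_pos (by omega)]

theorem contr_disjoint {α : Type*} {n : ℕ} (S : SLP α n) (i : Fin n) :
    Pairwise fun c c' => Disjoint (S.contr i c) (S.contr i c') := by
  rintro ⟨k, b⟩ ⟨k', b'⟩ hne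
  rw [Set.disjoint_left]
  intro x hx hx'
  apply hne
  have hn : 0 < n := Nat.lt_of_le_of_lt (Nat.zero_le _) i.isLt
  obtain ⟨h1, u, m, hm, hm1, hb⟩ := S.contr_parent x ⟨n - 1, by omega⟩ rfl i k b hx
  obtain ⟨h1', u', m', hm', hm1', hb'⟩ := S.contr_parent x ⟨n - 1, by omega⟩ rfl i k' b' hx'
  have hmm : m = m' := by
    rcases lt_trichotomy m m' with h | h | h
    · exfalso
      obtain ⟨d, rfl⟩ := Nat.exists_eq_add_of_lt h
      have := S.stp_iter_le x (⟨n - 1, by omega⟩, 1) (m + 1) d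
      rw [hm1, show m + 1 + d = m + d + 1 by omega, hm'] at this
      exact absurd h1' (not_lt.mpr this)
    · exact h
    · exfalso
      obtain ⟨d, rfl⟩ := Nat.exists_eq_add_of_lt h
      have := S.stp_iter_le x (⟨n - 1, by omega⟩, 1) (m' + 1) d
      rw [hm1', show m' + 1 + d = m' + d + 1 by omega, hm] at this
      exact absurd h1 (not_lt.mpr this)
  subst hmm
  rw [hm] at hm'
  obtain ⟨rfl, rfl⟩ := Prod.mk.inj hm'
  have : b = b' := by
    rw [Bool.eq_iff_iff, hb, hb']
  rw [this]

theorem st_finite {α : Type*} {n : ℕ} (S : SLP α n) (i : Fin n) : (S.st i).Finite := by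
  induction i using down_induction with
  | h i ih =>
    by_cases hi : i.val = n - 1
    · rw [S.st_last hi]; exact Set.finite_singleton _
    · rw [S.st_not_last hi]
      refine Set.finite_iUnion fun c => ?_
      unfold contr
      rcases h : S.rule c.1 with a | ⟨l, r⟩
      · simp
      · have hw := S.wf _ _ _ h
        rcases c with ⟨k, _ | _⟩
        · dsimp only
          split_ifs with e
          · exact (ih k (e ▸ hw.2)).image _
          · exact Set.finite_empty
        · dsimp only
          split_ifs with e
          · exact ih k (e ▸ hw.1)
          · exact Set.finite_empty

theorem contr_ncard {α : Type*} {n : ℕ} (S : SLP α n) (i : Fin n) (k : Fin n) :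
    (S.contr i (k, true)).ncard + (S.contr i (k, false)).ncard =
    match S.rule k with
    | Sum.inl _ => 0
    | Sum.inr (l, r) => (if l = i then S.vOcc k else 0) + (if r = i then S.vOcc k else 0) := by
  unfold contr
  rcases h : S.rule k with a | ⟨l, r⟩
  · simp [h]
  · simp only [h]
    congr 1
    · split_ifs
      · exact S.ncard_st k
      · simp
    · split_ifs
      · rw [Set.ncard_image_of_injective _ (fun a b h => by simpa using h)]
        exact S.ncard_st k
      · simp

theorem ncard_iUnion_aux {ι : Type*} [Fintype ι] (f : ι → Set ℕ) (hf : ∀ i, (f i).Finite)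
    (hd : Pairwise fun c c' => Disjoint (f c) (f c')) :
    (⋃ c, f c).ncard = ∑ c, (f c).ncard := by
  classical
  have : (⋃ c, f c) = ((Finset.univ.biUnion fun c => (hf c).toFinset : Finset ℕ) : Set ℕ) := by
    ext x; simp
  rw [this, Set.ncard_coe_finset, Finset.card_biUnion]
  · refine Finset.sum_congr rfl fun c _ => ?_
    rw [Set.ncard_eq_toFinset_card _ (hf c)]
  · intro c _ c' _ hne
    have := hd hne
    simpa using this

theorem vOcc_last {α : Type*} {n : ℕ} (S : SLP α n) {i : Fin n} (h : i.val = n - 1) :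
    S.vOcc i = 1 := by
  rw [← ncard_st, S.st_last h, Set.ncard_singleton]

theorem vOcc_not_last {α : Type*} {n : ℕ} (S : SLP α n) {i : Fin n} (h : i.val ≠ n - 1) :
    S.vOcc i = ∑ k, match S.rule k with
    | Sum.inl _ => 0
    | Sum.inr (l, r) => (if l = i then S.vOcc k else 0) + (if r = i then S.vOcc k else 0) := by
  have hfin : ∀ c, (S.contr i c).Finite := fun c => (S.st_finite i).subset (by
    rw [S.st_not_last h]; exact Set.subset_iUnion _ c)
  rw [← ncard_st, S.st_not_last h, ncard_iUnion_aux _ hfin (S.contr_disjoint i),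
    Fintype.sum_prod_type]
  refine Finset.sum_congr rfl fun k _ => ?_
  rw [Fintype.sum_bool]
  exact S.contr_ncard i k

theorem vOcc_parents_last {α : Type*} {n : ℕ} (S : SLP α n) {i : Fin n} (h : i.val = n - 1) :
    (∑ k, match S.rule k with
    | Sum.inl _ => 0
    | Sum.inr (l, r) => (if l = i then S.vOcc k else 0) + (if r = i then S.vOcc k else 0)) = 0 := by
  refine Finset.sum_eq_zero fun k _ => ?_
  rcases hr : S.rule k with a | ⟨l, r⟩
  · rfl
  · have hw := S.wf _ _ _ hr
    have hk := k.isLt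
    have h1 : l ≠ i := by rintro rfl; have := hw.1; rw [Fin.lt_def] at this; omega
    have h2 : r ≠ i := by rintro rfl; have := hw.2; rw [Fin.lt_def] at this; omega
    simp [h1, h2]

/-- weight identity -/
theorem weight_sum {α : Type*} {n : ℕ} (S : SLP α n) (top : Fin n) (htop : top.val = n - 1)
    (c t : Fin n → ℕ) (h0 : ∀ i a, S.rule i = Sum.inl a → c i = 0 ∧ t i = 0)
    (h1 : ∀ i l r, S.rule i = Sum.inr (l, r) → c i = c l + c r + t i) :
    c top = ∑ i, S.vOcc i * t i := by
  have e1 : ∑ i, S.vOcc i * c i = c top + ∑ i, (∑ k, match S.rule k with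
    | Sum.inl _ => 0
    | Sum.inr (l, r) => (if l = i then S.vOcc k else 0) + (if r = i then S.vOcc k else 0)) * c i := by
    have : c top = ∑ i, if i = top then c i else 0 := by simp
    rw [this, ← Finset.sum_add_distrib]
    refine Finset.sum_congr rfl fun i _ => ?_
    by_cases hi : i.val = n - 1
    · have : i = top := Fin.ext (by omega)
      rw [S.vOcc_parents_last hi, S.vOcc_last hi, if_pos this]; ring
    · have : i ≠ top := by rintro rfl; exact hi htop
      rw [if_neg this, ← S.vOcc_not_last hi]; ring
  have e2 : ∑ i, S.vOcc i * c i = (∑ i, (∑ k, match S.rule k with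
    | Sum.inl _ => 0
    | Sum.inr (l, r) => (if l = i then S.vOcc k else 0) + (if r = i then S.vOcc k else 0)) * c i)
      + ∑ i, S.vOcc i * t i := by
    simp_rw [Finset.sum_mul]
    rw [Finset.sum_comm, ← Finset.sum_add_distrib]
    refine Finset.sum_congr rfl fun k _ => ?_
    rcases hr : S.rule k with a | ⟨l, r⟩
    · simp [h0 k a hr]
    · simp only [add_mul, Finset.sum_add_distrib, ite_mul, zero_mul, Finset.sum_ite_eq,
        Finset.mem_univ, if_true]
      rw [h1 k l r hr]; ring
  omega

theorem Occ_top {α : Type*} {n : ℕ} (S : SLP α n) (top : Fin n) (htop : top.val = n - 1)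
    (q : ℕ) (hq : 2 ≤ q) (P : List α) (hP : P.length = q) :
    (Occ (S.val top) P).ncard = ∑ i, S.vOcc i * (Occ (S.tstr q i) P).ncard := by
  apply S.weight_sum top htop (fun i => (Occ (S.val i) P).ncard)
    (fun i => (Occ (S.tstr q i) P).ncard)
  · intro i a h
    refine ⟨?_, ?_⟩
    · simp only [S.val_inl h]
      exact Occ_singleton a P (by omega)
    · simp only [tstr, h]
      exact Occ_nil P (by omega)
  · intro i l r h
    simp only [S.val_inr h, tstr, h]
    exact Occ_append _ _ P q hq hP

end SLP

/-- q-gram spectrum kernel on SLPs: for SLPs representing `T₁` and `T₂`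
over a finite alphabet and `q ≥ 2`, the `q`-gram spectrum kernel
`K_q(T₁,T₂) = Σ_{P ∈ Σ^q} |Occ(T₁,P)|·|Occ(T₂,P)|` equals
`Σ_{i : Xᵢ = X_ℓ X_r} Σ_{j : Yⱼ = Y_ℓ' Y_r'} vOcc(Xᵢ)·vOcc(Yⱼ)·Σ_{P ∈ Σ^q} |Occ(tᵢ,P)|·|Occ(t'ⱼ,P)|`. -/
theorem slp_spectrum_kernel {α : Type*} [Finite α] {n₁ n₂ : ℕ}
    (S₁ : SLP α n₁) (S₂ : SLP α n₂) (hn₁ : 0 < n₁) (hn₂ : 0 < n₂)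
    (q : ℕ) (hq : 2 ≤ q) :
    (∑ᶠ P ∈ {P : List α | P.length = q},
        (Occ (S₁.val ⟨n₁ - 1, Nat.sub_lt hn₁ one_pos⟩) P).ncard *
        (Occ (S₂.val ⟨n₂ - 1, Nat.sub_lt hn₂ one_pos⟩) P).ncard) =
      ∑ i : Fin n₁, ∑ j : Fin n₂,
        (match S₁.rule i, S₂.rule j with
          | Sum.inr _, Sum.inr _ =>
              S₁.vOcc i * S₂.vOcc j *
                ∑ᶠ P ∈ {P : List α | P.length = q},
                  (Occ (S₁.tstr q i) P).ncard * (Occ (S₂.tstr q j) P).ncard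
          | _, _ => 0) := by
  have hfin : {P : List α | P.length = q}.Finite := List.finite_length_eq α q
  simp only [finsum_mem_eq_finite_toFinset_sum _ hfin]
  have key : ∀ P ∈ hfin.toFinset,
      (Occ (S₁.val ⟨n₁ - 1, Nat.sub_lt hn₁ one_pos⟩) P).ncard *
        (Occ (S₂.val ⟨n₂ - 1, Nat.sub_lt hn₂ one_pos⟩) P).ncard =
      ∑ i : Fin n₁, ∑ j : Fin n₂, S₁.vOcc i * S₂.vOcc j *
        ((Occ (S₁.tstr q i) P).ncard * (Occ (S₂.tstr q j) P).ncard) := by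
    intro P hP
    have hP' : P.length = q := by simpa using hP
    rw [S₁.Occ_top _ rfl q hq P hP', S₂.Occ_top _ rfl q hq P hP', Finset.sum_mul_sum]
    refine Finset.sum_congr rfl fun i _ => Finset.sum_congr rfl fun j _ => ?_
    ring
  rw [Finset.sum_congr rfl key, Finset.sum_comm]
  refine Finset.sum_congr rfl fun i _ => ?_
  rw [Finset.sum_comm]
  refine Finset.sum_congr rfl fun j _ => ?_
  rw [← Finset.mul_sum]
  have hz : ∀ P ∈ hfin.toFinset, (Occ ([] : List α) P).ncard = 0 := by
    intro P hP
    have hP' : P.length = q := by simpa using hP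
    exact Occ_nil P (by omega)
  rcases h1 : S₁.rule i with a | ⟨l, r⟩
  · have ht : S₁.tstr q i = [] := by simp [SLP.tstr, h1]
    rw [ht, Finset.sum_eq_zero (fun P hP => by rw [hz P hP, zero_mul])]
    simp
  · rcases h2 : S₂.rule j with a | ⟨l', r'⟩
    · have ht : S₂.tstr q j = [] := by simp [SLP.tstr, h2]
      rw [ht, Finset.sum_eq_zero (fun P hP => by rw [hz P hP, mul_zero])]
      simp
    · rfl
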